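/- arXiv:1707.05058 — 2 statements merged into one kernel-verified Lean document; each statement's English description precedes it below -/
import Mathlib

section
/- Let G(V,E) be a chordal graph with maximal cliques C_1, …, C_p, and let X ∈ S^n(E,0). Then X ∈ S^n_+(E,?) (i.e., X admits a positive semidefinite completion) if and only if E_{C_k} X E_{C_k}^T ⪰ 0 for every k = 1, …, p. -/
open Matrix BigOperators

/-- The edge set augmented with all self-loops: `E* = E ∪ {(i,i) : i ∈ V}`. -/
def EStar {n : ℕ} (E : Set (Fin n × Fin n)) : Set (Fin n × Fin n) :=
  E ∪ {q | q.1 = q.2}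

/-- The edge set of an undirected graph is symmetric. -/
def SymmEdges {n : ℕ} (E : Set (Fin n × Fin n)) : Prop :=
  ∀ i j : Fin n, (i, j) ∈ E → (j, i) ∈ E

/-- `S^n(E,0)`: real symmetric `n × n` matrices vanishing outside `E*`. -/
def SparseSym {n : ℕ} (E : Set (Fin n × Fin n)) (X : Matrix (Fin n) (Fin n) ℝ) : Prop :=
  X.IsSymm ∧ ∀ i j : Fin n, (i, j) ∉ EStar E → X i j = 0

/-- `S^n_+(E,?)`: matrices in `S^n(E,0)` admitting a positive semidefinite completion. -/
def PSDCompletable {n : ℕ} (E : Set (Fin n × Fin n)) (X : Matrix (Fin n) (Fin n) ℝ) : Prop :=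
  SparseSym E X ∧ ∃ M : Matrix (Fin n) (Fin n) ℝ, M.PosSemidef ∧
    ∀ i j : Fin n, (i, j) ∈ EStar E → M i j = X i j

/-- `S^n_+(E,0)`: positive semidefinite matrices with sparsity pattern `E`. -/
def SparsePSD {n : ℕ} (E : Set (Fin n × Fin n)) (X : Matrix (Fin n) (Fin n) ℝ) : Prop :=
  SparseSym E X ∧ X.PosSemidef

/-- The selector matrix `E_C ∈ R^{|C| × n}` of a subset `C ⊆ {1,…,n}`:
`(E_C)_{ij} = 1` if the `i`-th smallest element of `C` equals `j`, and `0` otherwise. -/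
def selector {n : ℕ} (C : Finset (Fin n)) : Matrix (Fin C.card) (Fin n) ℝ :=
  Matrix.of fun i j => if (C.orderIsoOfFin rfl i).1 = j then 1 else 0

/-- A clique: a subset of vertices inducing a complete subgraph. -/
def IsClique {n : ℕ} (E : Set (Fin n × Fin n)) (C : Finset (Fin n)) : Prop :=
  ∀ i ∈ C, ∀ j ∈ C, i ≠ j → (i, j) ∈ E

/-- A maximal clique: a clique not contained in any other clique. -/
def IsMaximalClique {n : ℕ} (E : Set (Fin n × Fin n)) (C : Finset (Fin n)) : Prop :=
  IsClique E C ∧ ∀ D : Finset (Fin n), IsClique E D → C ⊆ D → D = C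

/-- A cycle of length `k+1`: pairwise distinct vertices consecutively adjacent (cyclically). -/
def IsCycle {n : ℕ} (E : Set (Fin n × Fin n)) {k : ℕ} (v : Fin (k + 1) → Fin n) : Prop :=
  Function.Injective v ∧ ∀ i : Fin (k + 1), (v i, v (i + 1)) ∈ E

/-- A chord: an edge joining two non-consecutive vertices of the cycle. -/
def HasChord {n : ℕ} (E : Set (Fin n × Fin n)) {k : ℕ} (v : Fin (k + 1) → Fin n) : Prop :=
  ∃ i j : Fin (k + 1), i ≠ j ∧ j ≠ i + 1 ∧ i ≠ j + 1 ∧ (v i, v j) ∈ E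

/-- A graph is chordal if every cycle of length at least four has a chord. -/
def IsChordal {n : ℕ} (E : Set (Fin n × Fin n)) : Prop :=
  ∀ k : ℕ, 4 ≤ k + 1 → ∀ v : Fin (k + 1) → Fin n, IsCycle E v → HasChord E v

namespace SimpleGraph

variable {V : Type*} (G : SimpleGraph V)

/-- The graph on the same vertex type keeping only the edges with both ends in `W`. -/
def restrictTo (W : Set V) : SimpleGraph V where
  Adj u v := G.Adj u v ∧ u ∈ W ∧ v ∈ W
  symm := ⟨fun _ _ h => ⟨h.1.symm, h.2.2, h.2.1⟩⟩
  loopless := ⟨fun _ h => h.1.ne rfl⟩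

/-- Every cycle of length at least four has a chord. -/
def HasChords : Prop :=
  ∀ k : ℕ, 4 ≤ k + 1 → ∀ v : Fin (k + 1) → V, Function.Injective v →
    (∀ i, G.Adj (v i) (v (i + 1))) →
      ∃ i j : Fin (k + 1), i ≠ j ∧ j ≠ i + 1 ∧ i ≠ j + 1 ∧ G.Adj (v i) (v j)

variable {G}

theorem restrictTo_mono {W W' : Set V} (h : W ⊆ W') : G.restrictTo W ≤ G.restrictTo W' :=
  fun _ _ hadj => ⟨hadj.1, h hadj.2.1, h hadj.2.2⟩

/-- A set closed under adjacency is closed under reachability. -/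
theorem Reachable.mem_of_closed {P : Set V} (hP : ∀ u ∈ P, ∀ v, G.Adj u v → v ∈ P) {u v : V}
    (h : G.Reachable u v) (hu : u ∈ P) : v ∈ P := by
  rw [reachable_iff_reflTransGen] at h
  induction h with
  | refl => exact hu
  | tail _ hadj ih => exact hP _ ih _ hadj

theorem Reachable.mem_of_restrictTo {W : Set V} {u v : V} (h : (G.restrictTo W).Reachable u v)
    (hu : u ∈ W) : v ∈ W :=
  h.mem_of_closed (G := G.restrictTo W) (fun _ _ _ hadj => hadj.2.2) hu

/-- A component of `G.restrictTo W` is connected by edges within the component. -/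
theorem Reachable.restrictTo_component {W : Set V} {a u : V}
    (h : (G.restrictTo W).Reachable a u) :
    (G.restrictTo {v | (G.restrictTo W).Reachable a v}).Reachable a u := by
  have key := h.mem_of_closed (P := {v | (G.restrictTo W).Reachable a v ∧
    (G.restrictTo {v | (G.restrictTo W).Reachable a v}).Reachable a v}) ?_ ⟨.refl _, .refl _⟩
  · exact key.2
  · rintro u ⟨hu, hu'⟩ v hadj
    have hv := hu.trans hadj.reachable
    exact ⟨hv, hu'.trans (Adj.reachable ⟨hadj.1, hu, hv⟩)⟩

/-- A shortest walk gives an induced path. -/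
theorem Reachable.exists_induced_path {x y : V} (h : G.Reachable x y) :
    ∃ (m : ℕ) (p : ℕ → V), p 0 = x ∧ p m = y ∧ (∀ i < m, G.Adj (p i) (p (i + 1))) ∧
      (∀ i j, i < j → j ≤ m → p i ≠ p j) ∧
      ∀ i j, i < j → j ≤ m → G.Adj (p i) (p j) → j = i + 1 := by
  obtain ⟨w, hw⟩ := h.exists_walk_length_eq_dist
  have key : ∀ i j, i < j → j ≤ w.length → j ≤ i + G.dist (w.getVert i) (w.getVert j) := by
    intro i j hij hj
    have h1 : G.dist x (w.getVert i) ≤ i := (dist_le (w.take i)).trans (by simp)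
    have h2 : G.dist (w.getVert j) y ≤ w.length - j := (dist_le (w.drop j)).trans (by simp)
    have h3 := (w.take i).reachable.dist_triangle_left y
    have h4 := (w.drop j).reachable.dist_triangle_right (w.getVert i)
    omega
  refine ⟨w.length, w.getVert, w.getVert_zero, w.getVert_length,
    fun i hi => w.adj_getVert_succ hi, fun i j hij hj heq => ?_, fun i j hij hj hadj => ?_⟩
  · have := key i j hij hj
    rw [heq, dist_self] at this
    omega
  · have := key i j hij hj
    rw [dist_eq_one_iff_adj.2 hadj] at this
    omega

/-- Nonadjacent vertices joined through a component are joined by an induced path whose interior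
lies in that component. -/
theorem exists_induced_path_through {W : Set V} {a x y : V} (hxy : x ≠ y) (hnadj : ¬ G.Adj x y)
    (hx : ∃ u, (G.restrictTo W).Reachable a u ∧ G.Adj u x)
    (hy : ∃ u, (G.restrictTo W).Reachable a u ∧ G.Adj u y) :
    ∃ (m : ℕ) (p : ℕ → V), 2 ≤ m ∧ p 0 = x ∧ p m = y ∧ (∀ i < m, G.Adj (p i) (p (i + 1))) ∧
      (∀ i j, i < j → j ≤ m → p i ≠ p j) ∧
      (∀ i j, i < j → j ≤ m → G.Adj (p i) (p j) → j = i + 1) ∧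
      ∀ i, 0 < i → i < m → (G.restrictTo W).Reachable a (p i) := by
  obtain ⟨u, hau, hux⟩ := hx
  obtain ⟨u', hau', huy⟩ := hy
  set A : Set V := {v | (G.restrictTo W).Reachable a v}
  set W' : Set V := A ∪ {x, y} with hW'
  have hmono : G.restrictTo A ≤ G.restrictTo W' := restrictTo_mono Set.subset_union_left
  have hreach : (G.restrictTo W').Reachable x y :=
    (show (G.restrictTo W').Adj x u from ⟨hux.symm, by simp [hW'], Or.inl hau⟩).reachable.trans <|
      (hau.restrictTo_component.mono hmono).symm.trans <|
      (hau'.restrictTo_component.mono hmono).trans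
        (show (G.restrictTo W').Adj u' y from ⟨huy, Or.inl hau', by simp [hW']⟩).reachable
  obtain ⟨m, p, h0, hm, hadj, hinj, hind⟩ := hreach.exists_induced_path
  have hmem : ∀ i ≤ m, p i ∈ W' := by
    intro i hi
    rcases Nat.eq_zero_or_pos i with rfl | hi0
    · simp [h0, hW']
    · have := (hadj (i - 1) (by omega)).2.2
      rwa [Nat.sub_add_cancel hi0] at this
  have hm2 : 2 ≤ m := by
    by_contra hlt
    obtain rfl | rfl : m = 0 ∨ m = 1 := by omega
    · exact hxy (h0.symm.trans hm)
    · have := (hadj 0 one_pos).1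
      rw [zero_add, h0, hm] at this
      exact hnadj this
  refine ⟨m, p, hm2, h0, hm, fun i hi => (hadj i hi).1, hinj, fun i j hij hj h =>
    hind i j hij hj ⟨h, hmem i (by omega), hmem j hj⟩, fun i hi0 him => ?_⟩
  rcases hmem i him.le with h | h | h
  · exact h
  · exact absurd (h0.trans h.symm) (hinj 0 i hi0 him.le)
  · exact absurd (h.trans hm.symm) (hinj i m him le_rfl)

/-- In a chordal graph, two common neighbours of two distinct components of an induced subgraph
are adjacent. -/
theorem HasChords.adj_of_common_neighbors (hG : G.HasChords) {W : Set V} {a b x y : V}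
    (ha : a ∈ W) (hb : b ∈ W)
    (hab : ¬ (G.restrictTo W).Reachable a b) (hxy : x ≠ y)
    (hax : ∃ u, (G.restrictTo W).Reachable a u ∧ G.Adj u x)
    (hay : ∃ u, (G.restrictTo W).Reachable a u ∧ G.Adj u y)
    (hbx : ∃ u, (G.restrictTo W).Reachable b u ∧ G.Adj u x)
    (hby : ∃ u, (G.restrictTo W).Reachable b u ∧ G.Adj u y) : G.Adj x y := by
  by_contra hnadj
  obtain ⟨m, p, hm, p0, pm, padj, pinj, pind, pmem⟩ :=
    exists_induced_path_through hxy hnadj hax hay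
  obtain ⟨l, q, hl, q0, ql, qadj, qinj, qind, qmem⟩ :=
    exists_induced_path_through hxy.symm (fun h => hnadj h.symm) hby hbx
  have hdisj : ∀ u v, (G.restrictTo W).Reachable a u → (G.restrictTo W).Reachable b v →
      u ≠ v ∧ ¬ G.Adj u v := by
    refine fun u v hu hv => ⟨?_, fun h => ?_⟩
    · rintro rfl
      exact hab (hu.trans hv.symm)
    · exact hab ((hu.trans (Adj.reachable
        ⟨h, hu.mem_of_restrictTo ha, hv.mem_of_restrictTo hb⟩)).trans hv.symm)
  obtain ⟨k, hk⟩ : ∃ k, m + l = k + 1 := ⟨m + l - 1, by omega⟩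
  let c : ℕ → V := fun t => if t < m then p t else q (t - m)
  have cp : ∀ t ≤ m, c t = p t := by
    intro t ht
    rcases ht.lt_or_eq with h | rfl
    · simp [c, h]
    · simp [c, q0, pm]
  have cq : ∀ t, m ≤ t → c t = q (t - m) := fun t ht => by simp [c, ht.not_gt]
  have cend : c (k + 1) = c 0 := by
    rw [cp 0 (by omega), cq _ (by omega), ← hk, Nat.add_sub_cancel_left, ql, p0]
  have cross : ∀ i j, 0 < i → i < m → m < j → j ≤ k → c i ≠ c j ∧ ¬ G.Adj (c i) (c j) := by
    intro i j hi him hmj hjk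
    rw [cp i him.le, cq j hmj.le]
    exact hdisj _ _ (pmem i hi him) (qmem _ (by omega) (by omega))
  have cinj : ∀ i j, i < j → j ≤ k → c i ≠ c j := by
    intro i j hij hj
    rcases le_or_gt j m with h | h
    · rw [cp i (by omega), cp j h]
      exact pinj i j hij h
    · rcases le_or_gt m i with h' | h'
      · rw [cq i h', cq j h.le]
        exact qinj _ _ (by omega) (by omega)
      · rcases Nat.eq_zero_or_pos i with rfl | hi
        · rw [← cend, cq j h.le, cq _ (by omega)]
          exact (qinj _ _ (by omega) (by omega)).symm
        · exact (cross i j hi h' h hj).1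
  have cchord : ∀ i j, i < j → j ≤ k → G.Adj (c i) (c j) → j = i + 1 ∨ (i = 0 ∧ j = k) := by
    intro i j hij hj hadj
    rcases le_or_gt j m with h | h
    · rw [cp i (by omega), cp j h] at hadj
      exact Or.inl (pind i j hij h hadj)
    · rcases le_or_gt m i with h' | h'
      · rw [cq i h', cq j h.le] at hadj
        have := qind _ _ (by omega) (by omega) hadj
        omega
      · rcases Nat.eq_zero_or_pos i with rfl | hi
        · rw [← cend, cq j h.le, cq _ (by omega)] at hadj
          have := qind _ _ (by omega) (by omega) hadj.symm
          omega
        · exact absurd hadj (cross i j hi h' h hj).2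
  have cadj : ∀ i ≤ k, G.Adj (c i) (c (i + 1)) := by
    intro i hi
    rcases lt_or_ge i m with h | h
    · rw [cp i h.le, cp _ h]
      exact padj i h
    · rw [cq i h, cq _ (by omega), Nat.sub_add_comm h]
      exact qadj _ (by omega)
  have csucc : ∀ i : Fin (k + 1), c ((i + 1 : Fin (k + 1)) : ℕ) = c ((i : ℕ) + 1) := by
    intro i
    rw [Fin.val_add_one]
    split_ifs with h
    · rw [h, Fin.val_last, cend]
    · rfl
  have cinj' : Function.Injective fun i : Fin (k + 1) => c i := by
    intro i j hij
    by_contra hne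
    rcases lt_or_gt_of_ne hne with h | h
    · exact cinj i j h (by omega) hij
    · exact cinj j i h (by omega) hij.symm
  obtain ⟨i, j, hij, hji, hij', hadj⟩ := hG k (by omega) (fun i => c i) cinj' fun i => by
    rw [csucc]
    exact cadj i (by omega)
  have succ_of : ∀ i j : Fin (k + 1), (j : ℕ) = i + 1 ∨ (j : ℕ) = 0 ∧ (i : ℕ) = k → j = i + 1 := by
    intro i j h
    ext
    rw [Fin.val_add_one]
    split_ifs with hlast
    · have hik : (i : ℕ) = k := congrArg Fin.val hlast
      have := j.isLt
      omega
    · have : (i : ℕ) ≠ k := fun h => hlast (Fin.ext h)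
      omega
  rcases lt_or_gt_of_ne hij with h | h
  · rcases cchord i j h (by omega) hadj with h' | h'
    · exact hji (succ_of i j (Or.inl h'))
    · exact hij' (succ_of j i (Or.inr h'))
  · rcases cchord j i h (by omega) hadj.symm with h' | h'
    · exact hij' (succ_of j i (Or.inl h'))
    · exact hji (succ_of i j (Or.inr h'))

/-- Adding a vertex without neighbours in the component of `a` does not enlarge that component. -/
theorem exists_adj_of_reachable_insert {W : Set V} {a b x : V} (ha : a ∈ W)
    (hab : ¬ (G.restrictTo W).Reachable a b)
    (hab' : (G.restrictTo (insert x W)).Reachable a b) :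
    ∃ u, (G.restrictTo W).Reachable a u ∧ G.Adj u x := by
  by_contra! hno
  refine hab (hab'.mem_of_closed (P := {v | (G.restrictTo W).Reachable a v}) ?_ (.refl _))
  rintro u hu v ⟨hadj, -, rfl | hv⟩
  · exact absurd hadj (hno u hu)
  · exact hu.trans (Adj.reachable
      ⟨hadj, hu.mem_of_restrictTo ha, hv⟩)

/-- A set of vertices of a chordal graph that is not a clique splits along a clique separator. -/
theorem HasChords.exists_clique_separation [Finite V] (hG : G.HasChords) {S : Set V} {a b : V}
    (ha : a ∈ S) (hb : b ∈ S) (hne : a ≠ b) (hnadj : ¬ G.Adj a b) :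
    ∃ A B : Set V, A ⊂ S ∧ B ⊂ S ∧ A ∪ B = S ∧ G.IsClique (A ∩ B) ∧
      ∀ u ∈ A \ B, ∀ v ∈ B \ A, ¬ G.Adj u v := by
  obtain ⟨T, ⟨⟨hTS, haT, hbT⟩, hsep⟩, hmin⟩ := exists_minimal_of_wellFoundedLT
    (fun T : Set V => (T ⊆ S ∧ a ∉ T ∧ b ∉ T) ∧ ¬ (G.restrictTo (S \ T)).Reachable a b)
    ⟨S \ {a, b}, ⟨Set.sdiff_subset, by simp, by simp⟩, fun h => by
      have := h.mem_of_closed (P := {a}) ?_ rfl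
      · exact hne this.symm
      · rintro u hu v ⟨hadj, -, hvS, hv⟩
        rw [Set.mem_singleton_iff.1 hu] at hadj
        have hv' : v = a ∨ v = b := by
          by_contra hv''
          exact hv ⟨hvS, hv''⟩
        rcases hv' with rfl | rfl
        · rfl
        · exact absurd hadj hnadj⟩
  have haW : a ∈ S \ T := ⟨ha, haT⟩
  have hbW : b ∈ S \ T := ⟨hb, hbT⟩
  have hjoin : ∀ x ∈ T, (G.restrictTo (insert x (S \ T))).Reachable a b := by
    intro x hx
    by_contra hnr
    have hle := hmin (y := T \ {x}) ⟨⟨Set.sdiff_subset.trans hTS, fun h => haT h.1,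
      fun h => hbT h.1⟩, fun h => hnr (h.mono (restrictTo_mono ?_))⟩ Set.sdiff_subset
    · exact (hle hx).2 rfl
    · rintro v ⟨hvS, hv⟩
      by_cases hvx : v = x
      · exact Or.inl hvx
      · exact Or.inr ⟨hvS, fun h => hv ⟨h, hvx⟩⟩
  set A : Set V := {v | (G.restrictTo (S \ T)).Reachable a v} with hA
  have hAW : A ⊆ S \ T := fun v hv => Reachable.mem_of_restrictTo hv haW
  have hinter : (A ∪ T) ∩ (S \ A) = T := by
    ext v
    constructor
    · rintro ⟨h | h, -, h'⟩
      · exact absurd h h'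
      · exact h
    · exact fun h => ⟨Or.inr h, hTS h, fun h' => (hAW h').2 h⟩
  refine ⟨A ∪ T, S \ A, ⟨Set.union_subset (fun v hv => (hAW hv).1) hTS, fun h => ?_⟩,
    ⟨Set.sdiff_subset, fun h => (h ha).2 (Reachable.refl a)⟩, ?_, ?_, ?_⟩
  · exact (h hb).elim hsep hbT
  · ext v
    constructor
    · rintro ((h | h) | h)
      exacts [(hAW h).1, hTS h, h.1]
    · intro h
      by_cases hv : v ∈ A
      exacts [Or.inl (Or.inl hv), Or.inr ⟨h, hv⟩]
  · rw [hinter]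
    have hsep' : ¬ (G.restrictTo (S \ T)).Reachable b a := fun h => hsep h.symm
    exact fun x hx y hy hxy => hG.adj_of_common_neighbors haW hbW hsep hxy
      (exists_adj_of_reachable_insert haW hsep (hjoin x hx))
      (exists_adj_of_reachable_insert haW hsep (hjoin y hy))
      (exists_adj_of_reachable_insert hbW hsep' (hjoin x hx).symm)
      (exists_adj_of_reachable_insert hbW hsep' (hjoin y hy).symm)
  · rintro u ⟨hu, huB⟩ v ⟨hv, hvA⟩ hadj
    have huA : u ∈ A := by
      by_contra h
      exact huB ⟨hTS (hu.resolve_left h), h⟩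
    exact hvA (Or.inl (huA.trans (Adj.reachable
      ⟨hadj, hAW huA, hv.1, fun h => hvA (Or.inr h)⟩)))

end SimpleGraph

section Gram

variable {F : Type*} [NormedAddCommGroup F] [InnerProductSpace ℝ F] [FiniteDimensional ℝ F]

/-- Families of vectors with the same Gram matrix differ by a linear isometry. -/
theorem exists_linearIsometry_of_inner_eq {ι : Type*} {f g : ι → F}
    (h : ∀ i j, inner ℝ (f i) (f j) = inner ℝ (g i) (g j)) :
    ∃ u : F →ₗᵢ[ℝ] F, ∀ i, u (f i) = g i := by
  let Φ := Finsupp.linearCombination ℝ f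
  let Ψ := Finsupp.linearCombination ℝ g
  have hnorm : ∀ c, ‖Ψ c‖ = ‖Φ c‖ := by
    intro c
    have hinner : inner ℝ (Ψ c) (Ψ c) = inner ℝ (Φ c) (Φ c) := by
      simp only [Φ, Ψ, Finsupp.linearCombination_apply, Finsupp.sum, sum_inner, inner_sum,
        inner_smul_left, inner_smul_right, h]
    rw [real_inner_self_eq_norm_sq, real_inner_self_eq_norm_sq] at hinner
    exact (sq_eq_sq₀ (norm_nonneg _) (norm_nonneg _)).1 hinner
  obtain ⟨s, hs⟩ := Φ.rangeRestrict.exists_rightInverse_of_surjective Φ.range_rangeRestrict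
  have hs' : ∀ z, Φ (s z) = z := fun z => congrArg Subtype.val (LinearMap.congr_fun hs z)
  let L : LinearMap.range Φ →ₗᵢ[ℝ] F :=
    ⟨Ψ ∘ₗ s, fun z => by
      rw [LinearMap.comp_apply, hnorm, hs']
      rfl⟩
  have hL : ∀ c, L (Φ.rangeRestrict c) = Ψ c := by
    intro c
    rw [← sub_eq_zero, ← norm_eq_zero]
    change ‖Ψ (s (Φ.rangeRestrict c)) - Ψ c‖ = 0
    rw [← map_sub, hnorm, map_sub, hs']
    simp
  refine ⟨L.extend, fun i => ?_⟩
  have := L.extend_apply (Φ.rangeRestrict (Finsupp.single i 1))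
  rw [hL] at this
  simpa [Φ, Ψ] using this

/-- The vectors `v` indexed by `S` realize the entries of `X` on the diagonal and on the edges
of `G`. -/
def RealizesOn {V : Type*} (G : SimpleGraph V) (X : Matrix V V ℝ) (S : Set V) (v : V → F) : Prop :=
  ∀ i ∈ S, ∀ j ∈ S, i = j ∨ G.Adj i j → inner ℝ (v i) (v j) = X i j

theorem RealizesOn.glue {V : Type*} {G : SimpleGraph V} {X : Matrix V V ℝ} {A B : Set V}
    {v w : V → F} (hv : RealizesOn G X A v) (hw : RealizesOn G X B w) (hK : G.IsClique (A ∩ B))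
    (hsep : ∀ i ∈ A \ B, ∀ j ∈ B \ A, ¬ G.Adj i j) :
    ∃ z : V → F, RealizesOn G X (A ∪ B) z := by
  classical
  obtain ⟨u, hu⟩ := exists_linearIsometry_of_inner_eq
    (f := fun i : ↥(A ∩ B) => v i) (g := fun i => w i) fun i j => by
      have hij : (i : V) = j ∨ G.Adj i j := or_iff_not_imp_left.2 fun h => hK i.2 j.2 h
      rw [hv _ i.2.1 _ j.2.1 hij, hw _ i.2.2 _ j.2.2 hij]
  let z : V → F := fun i => if i ∈ B then w i else u (v i)
  have zB : ∀ i ∈ B, z i = w i := fun i hi => by simp [z, hi]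
  have zA : ∀ i ∈ A, z i = u (v i) := by
    intro i hi
    by_cases h : i ∈ B
    · rw [zB i h]
      exact (hu ⟨i, hi, h⟩).symm
    · simp [z, h]
  refine ⟨z, fun i hi j hj hij => ?_⟩
  by_cases hA : i ∈ A ∧ j ∈ A
  · rw [zA i hA.1, zA j hA.2, u.inner_map_map]
    exact hv i hA.1 j hA.2 hij
  by_cases hB : i ∈ B ∧ j ∈ B
  · rw [zB i hB.1, zB j hB.2]
    exact hw i hB.1 j hB.2 hij
  exfalso
  rcases hij with rfl | hij
  · exact hi.elim (fun h => hA ⟨h, h⟩) (fun h => hB ⟨h, h⟩)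
  · rcases hi with hi | hi <;> rcases hj with hj | hj
    · exact hA ⟨hi, hj⟩
    · exact hsep i ⟨hi, fun h => hB ⟨h, hj⟩⟩ j ⟨hj, fun h => hA ⟨hi, h⟩⟩ hij
    · exact hsep j ⟨hj, fun h => hB ⟨hi, h⟩⟩ i ⟨hi, fun h => hA ⟨h, hj⟩⟩ hij.symm
    · exact hB ⟨hi, hj⟩

/-- In a chordal graph, realizations on cliques yield a realization on every set of vertices. -/
theorem SimpleGraph.HasChords.exists_realizesOn {V : Type*} [Finite V] {G : SimpleGraph V}
    (hG : G.HasChords) {X : Matrix V V ℝ}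
    (hX : ∀ S : Set V, G.IsClique S → ∃ v : V → F, RealizesOn G X S v) (S : Set V) :
    ∃ v : V → F, RealizesOn G X S v := by
  induction S using WellFoundedLT.induction with
  | ind S ih =>
    by_cases hS : G.IsClique S
    · exact hX S hS
    · simp only [SimpleGraph.IsClique, Set.Pairwise] at hS
      push Not at hS
      obtain ⟨a, ha, b, hb, hne, hnadj⟩ := hS
      obtain ⟨A, B, hA, hB, rfl, hK, hsep⟩ := hG.exists_clique_separation ha hb hne hnadj
      obtain ⟨v, hv⟩ := ih A hA
      obtain ⟨w, hw⟩ := ih B hB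
      exact hv.glue hw hK hsep

end Gram

open scoped MatrixOrder in
/-- A positive semidefinite matrix is a Gram matrix. -/
theorem Matrix.PosSemidef.exists_gram_eq {ι : Type*} [Fintype ι] {M : Matrix ι ι ℝ}
    (hM : M.PosSemidef) : ∃ v : ι → EuclideanSpace ℝ ι, M = Matrix.gram ℝ v := by
  classical
  obtain ⟨B, rfl⟩ := CStarAlgebra.nonneg_iff_eq_star_mul_self.mp hM.nonneg
  refine ⟨fun i => WithLp.toLp 2 (B.col i), ?_⟩
  ext i j
  simp [Matrix.mul_apply, PiLp.inner_apply, Matrix.star_apply, mul_comm]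

theorem selector_mul_mul_transpose {n : ℕ} (C : Finset (Fin n)) (X : Matrix (Fin n) (Fin n) ℝ) :
    selector C * X * (selector C)ᵀ =
      X.submatrix (fun i => (C.orderIsoOfFin rfl i).1) (fun i => (C.orderIsoOfFin rfl i).1) := by
  ext i j
  simp only [selector, Matrix.mul_apply, Matrix.transpose_apply, Matrix.of_apply,
    Matrix.submatrix_apply, ite_mul, mul_ite, one_mul, mul_one, zero_mul, mul_zero,
    Finset.sum_ite_eq, Finset.mem_univ, if_true]

theorem selector_transpose_mul_mul_apply {n : ℕ} (C : Finset (Fin n))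
    (X : Matrix (Fin n) (Fin n) ℝ) {i j : Fin n} (hi : i ∈ C) (hj : j ∈ C) :
    ((selector C)ᵀ * (selector C * X * (selector C)ᵀ) * selector C) i j = X i j := by
  obtain ⟨i', hi'⟩ := (C.orderIsoOfFin rfl).surjective ⟨i, hi⟩
  obtain ⟨j', hj'⟩ := (C.orderIsoOfFin rfl).surjective ⟨j, hj⟩
  have hi'' : ∀ k, (C.orderIsoOfFin rfl k).1 = i ↔ k = i' := fun k => by
    rw [← (C.orderIsoOfFin rfl).injective.eq_iff, hi', Subtype.ext_iff]
  have hj'' : ∀ k, (C.orderIsoOfFin rfl k).1 = j ↔ k = j' := fun k => by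
    rw [← (C.orderIsoOfFin rfl).injective.eq_iff, hj', Subtype.ext_iff]
  rw [selector_mul_mul_transpose]
  simp only [selector, Matrix.mul_apply, Matrix.transpose_apply, Matrix.of_apply, hi'', hj'',
    Matrix.submatrix_apply, ite_mul, mul_ite, one_mul, mul_one, zero_mul, mul_zero,
    Finset.sum_ite_eq', Finset.mem_univ, if_true, hi', hj']

/-- The simple graph whose edges are the non-loops of `E`. -/
def edgeGraph {n : ℕ} (E : Set (Fin n × Fin n)) (hE : SymmEdges E) : SimpleGraph (Fin n) where
  Adj i j := i ≠ j ∧ (i, j) ∈ E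
  symm := ⟨fun _ _ h => ⟨h.1.symm, hE _ _ h.2⟩⟩
  loopless := ⟨fun _ h => h.1 rfl⟩

theorem IsChordal.hasChords {n : ℕ} {E : Set (Fin n × Fin n)} (hE : SymmEdges E)
    (h : IsChordal E) : (edgeGraph E hE).HasChords := by
  intro k hk v hinj hadj
  obtain ⟨i, j, hij, h1, h2, hmem⟩ := h k hk v ⟨hinj, fun i => (hadj i).2⟩
  exact ⟨i, j, hij, h1, h2, hinj.ne hij, hmem⟩

theorem IsClique.exists_isMaximalClique {n : ℕ} {E : Set (Fin n × Fin n)} {D : Finset (Fin n)}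
    (hD : IsClique E D) : ∃ C, D ⊆ C ∧ IsMaximalClique E C := by
  obtain ⟨C, hDC, hC, hmax⟩ := exists_maximal_ge_of_wellFoundedGT (IsClique E) D hD
  exact ⟨C, hDC, hC, fun D' hD' h => (hmax hD' h).antisymm h⟩

/-- **Grone's theorem.** Let `G(V,E)` be a chordal graph with maximal cliques `C_1, …, C_p`
and let `X ∈ S^n(E,0)`.  Then `X` admits a positive semidefinite completion if and only if
`E_{C_k} X E_{C_k}ᵀ ⪰ 0` for every `k = 1, …, p`. -/
theorem chordal_psd_completion {n p : ℕ} (E : Set (Fin n × Fin n)) (hE : SymmEdges E)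
    (hchordal : IsChordal E) (C : Fin p → Finset (Fin n))
    (hmax : ∀ k : Fin p, IsMaximalClique E (C k))
    (hall : ∀ D : Finset (Fin n), IsMaximalClique E D → ∃ k : Fin p, C k = D)
    (X : Matrix (Fin n) (Fin n) ℝ) (hX : SparseSym E X) :
    PSDCompletable E X ↔
      ∀ k : Fin p, (selector (C k) * X * (selector (C k))ᵀ).PosSemidef := by
  constructor
  · rintro ⟨-, M, hM, hMX⟩ k
    have hsub : selector (C k) * X * (selector (C k))ᵀ =
        selector (C k) * M * (selector (C k))ᵀ := by
      rw [selector_mul_mul_transpose, selector_mul_mul_transpose]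
      ext i j
      refine (hMX _ _ ?_).symm
      by_cases h : ((C k).orderIsoOfFin rfl i).1 = ((C k).orderIsoOfFin rfl j).1
      · exact Or.inr h
      · exact Or.inl ((hmax k).1 _ (Subtype.prop _) _ (Subtype.prop _) h)
    rw [hsub, selector_mul_mul_transpose]
    exact hM.submatrix _
  · intro h
    have hclique : ∀ S : Set (Fin n), (edgeGraph E hE).IsClique S →
        ∃ v : Fin n → EuclideanSpace ℝ (Fin n), RealizesOn (edgeGraph E hE) X S v := by
      classical
      intro S hS
      obtain ⟨D, hSD, hD⟩ := IsClique.exists_isMaximalClique (E := E) (D := S.toFinset)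
        fun i hi j hj hne => (hS (Set.mem_toFinset.1 hi) (Set.mem_toFinset.1 hj) hne).2
      obtain ⟨k, rfl⟩ := hall D hD
      have hpsd := (h k).conjTranspose_mul_mul_same (selector (C k))
      rw [Matrix.conjTranspose_eq_transpose_of_trivial] at hpsd
      obtain ⟨v, hv⟩ := hpsd.exists_gram_eq
      refine ⟨v, fun i hi j hj _ => ?_⟩
      rw [← selector_transpose_mul_mul_apply (C k) X (hSD (Set.mem_toFinset.2 hi))
        (hSD (Set.mem_toFinset.2 hj)), hv, Matrix.gram_apply]
    obtain ⟨v, hv⟩ := (hchordal.hasChords hE).exists_realizesOn hclique Set.univ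
    refine ⟨hX, Matrix.gram ℝ v, Matrix.posSemidef_gram ℝ v, fun i j hij => ?_⟩
    exact hv i trivial j trivial
      (or_iff_not_imp_left.2 fun hne => ⟨hne, hij.resolve_right hne⟩)
end

section
/- Let G(V,E) be a chordal graph with maximal cliques C_1, …, C_p, and suppose C ∈ S^n(E,0) and A_i ∈ S^n(E,0) for i = 1, …, m. Then the optimal value of the standard dual SDP, sup{b^T y : C − Σ_{i=1}^m A_i y_i ⪰ 0, y ∈ R^m}, equals the optimal value of the range-space decomposed SDP sup{b^T y : Σ_{i=1}^m A_i y_i + Σ_{k=1}^p E_{C_k}^T Z_k E_{C_k} = C, Z_k ⪰ 0 for k = 1,…,p}, where the second supremum is over y ∈ R^m and Z_1 ∈ S^{|C_1|}, …, Z_p ∈ S^{|C_p|}. -/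
open Matrix BigOperators

/-- A walk of length `L` from `a` to `c` in `E` whose interior vertices lie in `B`. -/
def IsWalkThrough {n : ℕ} (E : Set (Fin n × Fin n)) (B : Set (Fin n)) (a c : Fin n) (L : ℕ)
    (f : ℕ → Fin n) : Prop :=
  f 0 = a ∧ f L = c ∧ (∀ i, 0 < i → i < L → f i ∈ B) ∧ ∀ i < L, (f i, f (i + 1)) ∈ E

theorem IsWalkThrough.shortcut {n : ℕ} {E : Set (Fin n × Fin n)} {B : Set (Fin n)} {a c : Fin n}
    {L : ℕ} {f : ℕ → Fin n} (h : IsWalkThrough E B a c L f) {i j : ℕ} (hij : i < j) (hj : j ≤ L)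
    (hE : (f i, f j) ∈ E) :
    IsWalkThrough E B a c (L - (j - i - 1)) (fun t => if t ≤ i then f t else f (t + (j - i - 1))) := by
  obtain ⟨h0, hL, hB, hadj⟩ := h
  refine ⟨by simpa using h0, ?_, ?_, ?_⟩
  · dsimp only
    split_ifs
    · rw [← hL]; congr 1; omega
    · rw [← hL]; congr 1; omega
  · intro t ht htL
    dsimp only
    split_ifs
    · exact hB t ht (by omega)
    · exact hB _ (by omega) (by omega)
  · intro t ht
    dsimp only
    rcases lt_trichotomy t i with h | h | h
    · rw [if_pos (by omega), if_pos (by omega)]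
      exact hadj t (by omega)
    · subst h
      rw [if_pos le_rfl, if_neg (by omega), show t + 1 + (j - t - 1) = j by omega]
      exact hE
    · rw [if_neg (by omega), if_neg (by omega),
        show t + 1 + (j - i - 1) = t + (j - i - 1) + 1 by omega]
      exact hadj _ (by omega)

theorem IsWalkThrough.snoc {n : ℕ} {E : Set (Fin n × Fin n)} {B : Set (Fin n)} {a c d : Fin n}
    {L : ℕ} {f : ℕ → Fin n} (h : IsWalkThrough E B a c L f) (hc : c ∈ B) (hcd : (c, d) ∈ E) :
    IsWalkThrough E B a d (L + 1) (fun t => if t ≤ L then f t else d) := by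
  obtain ⟨h0, hL, hB, hadj⟩ := h
  refine ⟨by simpa using h0, by simp, ?_, ?_⟩
  · intro t ht htL
    dsimp only
    rw [if_pos (by omega)]
    rcases (show t < L ∨ t = L by omega) with h | h
    · exact hB t ht h
    · rwa [h, hL]
  · intro t ht
    dsimp only
    rw [if_pos (by omega)]
    rcases (show t < L ∨ t = L by omega) with h | h
    · rw [if_pos (by omega)]
      exact hadj t h
    · rw [if_neg (by omega), h, hL]
      exact hcd

/-- In a chordal graph, two common neighbours of `x` joined by a walk avoiding the closed
neighbourhood of `x` are adjacent. -/
theorem IsChordal.adj_of_isWalkThrough {n : ℕ} {E : Set (Fin n × Fin n)} (hE : SymmEdges E)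
    (hch : IsChordal E) {B : Set (Fin n)} {x a c : Fin n} (hxB : x ∉ B)
    (hB : ∀ z ∈ B, (x, z) ∉ E) (hax : a ≠ x) (hcx : c ≠ x) (hxa : (x, a) ∈ E) (hxc : (x, c) ∈ E)
    (hac : a ≠ c) (hw : ∃ L f, IsWalkThrough E B a c L f) : (a, c) ∈ E := by
  classical
  by_contra hnac
  obtain ⟨f, hf⟩ := Nat.find_spec hw
  have hmin := fun m hm => Nat.find_min (m := m) hw hm
  set L := Nat.find hw with hLdef
  have hf' := hf
  obtain ⟨h0, hL, hfB, hadj⟩ := hf'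
  have hL0 : L ≠ 0 := fun h => hac (by rw [← h0, ← hL, h])
  have hL1 : L ≠ 1 := fun h => hnac (by
    have := hadj 0 (by omega)
    rwa [h0, zero_add, ← h, hL] at this)
  have hshort : ∀ i j, i + 1 < j → j ≤ L → (f i, f j) ∉ E := fun i j hij hj hmem =>
    hmin _ (by omega) ⟨_, hf.shortcut (by omega) hj hmem⟩
  have hinj : ∀ i j, i < j → j ≤ L → f i ≠ f j := by
    intro i j hij hj heq
    rcases (show j < L ∨ j = L by omega) with h | h
    · exact hshort i (j + 1) (by omega) (by omega) (heq ▸ hadj j h)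
    · rcases Nat.eq_zero_or_pos i with hi | hi
      · exact hac (by rw [← h0, ← hL, ← h, ← heq, hi])
      · refine hshort (i - 1) j (by omega) hj ?_
        have := hadj (i - 1) (by omega)
        rwa [show i - 1 + 1 = i by omega, heq] at this
  have hfx : ∀ i ≤ L, f i ≠ x := by
    intro i hi heq
    rcases (show i = 0 ∨ i = L ∨ (0 < i ∧ i < L) by omega) with h | h | h
    · exact hax (by rw [← h0, ← h, heq])
    · exact hcx (by rw [← hL, ← h, heq])
    · exact hxB (heq ▸ hfB i h.1 h.2)
  let v : Fin (L + 1 + 1) → Fin n := fun i => if i.val ≤ L then f i.val else x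
  have hcyc : IsCycle E v := by
    refine ⟨?_, ?_⟩
    · intro i j hij
      have hi := i.isLt
      have hj := j.isLt
      simp only [v] at hij
      ext
      by_contra hne
      split_ifs at hij with h1 h2 h2
      · rcases Nat.lt_or_gt_of_ne hne with h | h
        · exact hinj _ _ h h2 hij
        · exact hinj _ _ h h1 hij.symm
      · exact hfx _ h1 hij
      · exact hfx _ h2 hij.symm
      · omega
    · intro i
      have hi := i.isLt
      simp only [v, Fin.val_add_one, Fin.ext_iff, Fin.val_last]
      rcases (show i.val < L ∨ i.val = L ∨ i.val = L + 1 by omega) with h | h | h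
      · rw [if_neg (show ¬i.val = L + 1 by omega), if_pos (by omega), if_pos (by omega)]
        exact hadj _ h
      · rw [if_neg (show ¬i.val = L + 1 by omega), if_pos (by omega), if_neg (by omega), h, hL]
        exact hE _ _ hxc
      · rw [if_neg (by omega), if_pos h, if_pos (by omega), h0]
        exact hxa
  obtain ⟨i, j, hne, hj, hi, hmem⟩ := hch (L + 1) (by omega) v hcyc
  have hil := i.isLt
  have hjl := j.isLt
  simp only [ne_eq, Fin.ext_iff, Fin.val_add_one, Fin.val_last] at hne hi hj
  simp only [v] at hmem
  have hxf : ∀ t, t ≠ 0 → t < L → (x, f t) ∉ E := fun t ht htL =>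
    hB _ (hfB t (by omega) htL)
  split_ifs at hmem with h1 h2 h2
  · rw [if_neg (by omega)] at hi hj
    rcases Nat.lt_or_gt_of_ne hne with h | h
    · exact hshort _ _ (by omega) h2 hmem
    · exact hshort _ _ (by omega) h1 (hE _ _ hmem)
  · rw [if_pos (by omega)] at hi
    rw [if_neg (by omega)] at hj
    exact hxf _ (by omega) (by omega) (hE _ _ hmem)
  · rw [if_pos (by omega)] at hj
    rw [if_neg (by omega)] at hi
    exact hxf _ (by omega) (by omega) hmem
  · omega

/-- `v` is simplicial in the subgraph induced by `S`: its neighbours in `S` form a clique. -/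
def IsSimplicialIn {n : ℕ} (E : Set (Fin n × Fin n)) (S : Finset (Fin n)) (v : Fin n) : Prop :=
  ∀ a ∈ S, ∀ c ∈ S, (v, a) ∈ E → (v, c) ∈ E → a ≠ c → (a, c) ∈ E

/-- Dirac's theorem, relative form: a vertex `x` of an induced subgraph of a chordal graph that is
not adjacent to all others misses some simplicial vertex. -/
theorem IsChordal.exists_isSimplicialIn_not_adj {n : ℕ} {E : Set (Fin n × Fin n)}
    (hE : SymmEdges E) (hch : IsChordal E) (S : Finset (Fin n)) :
    ∀ x ∈ S, ∀ y ∈ S, y ≠ x → (x, y) ∉ E →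
      ∃ w ∈ S, w ≠ x ∧ (x, w) ∉ E ∧ IsSimplicialIn E S w := by
  classical
  induction S using Finset.strongInduction with
  | H S ih =>
  intro x hx y hy hyx hxy
  let T : Set (Fin n) := {z | z ∈ S ∧ z ≠ x ∧ (x, z) ∉ E}
  let r : Fin n → Fin n → Prop := fun u w => w ∈ T ∧ (u, w) ∈ E
  let B : Set (Fin n) := {z | Relation.ReflTransGen r y z}
  have hyT : y ∈ T := ⟨hy, hyx, hxy⟩
  have hBT : ∀ z ∈ B, z ∈ T := by
    intro z hz
    rcases Relation.ReflTransGen.cases_tail hz with h | ⟨u, _, h⟩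
    · rwa [h]
    · exact h.1
  have hBcl : ∀ z ∈ B, ∀ w ∈ T, (z, w) ∈ E → w ∈ B := fun z hz w hw hzw =>
    Relation.ReflTransGen.tail hz ⟨hw, hzw⟩
  have hyB : y ∈ B := Relation.ReflTransGen.refl
  let S' : Finset (Fin n) := S.filter fun z => z ∈ B ∨ (z ≠ x ∧ (x, z) ∈ E ∧ ∃ u ∈ B, (u, z) ∈ E)
  have hS'S : S' ⊂ S := by
    refine Finset.filter_ssubset.2 ⟨x, hx, ?_⟩
    rintro (h | h)
    · exact (hBT x h).2.1 rfl
    · exact h.1 rfl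
  have hnbr : ∀ w ∈ B, ∀ a ∈ S, (w, a) ∈ E → a ∈ S' := by
    intro w hw a ha hwa
    refine Finset.mem_filter.2 ⟨ha, ?_⟩
    have hax : a ≠ x := fun h => (hBT w hw).2.2 (hE _ _ (h ▸ hwa))
    by_cases hxa : (x, a) ∈ E
    · exact Or.inr ⟨hax, hxa, w, hw, hwa⟩
    · exact Or.inl (hBcl w hw a ⟨ha, hax, hxa⟩ hwa)
  have hlift : ∀ w ∈ B, IsSimplicialIn E S' w →
      ∃ w ∈ S, w ≠ x ∧ (x, w) ∉ E ∧ IsSimplicialIn E S w := fun w hw hs =>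
    ⟨w, (hBT w hw).1, (hBT w hw).2.1, (hBT w hw).2.2, fun a ha c hc hwa hwc hac =>
      hs a (hnbr w hw a ha hwa) c (hnbr w hw c hc hwc) hwa hwc hac⟩
  have hBconn : ∀ a, ∀ u ∈ B, (u, a) ∈ E → ∀ w ∈ B, ∃ L f, IsWalkThrough E B a w L f := by
    intro a u hu hua w hw
    have hstep : ∀ z ∈ B, ∀ z', (z, z') ∈ E → (∃ L f, IsWalkThrough E B a z L f) →
        ∃ L f, IsWalkThrough E B a z' L f := fun z hz z' hzz' ⟨L, f, hf⟩ =>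
      ⟨L + 1, _, hf.snoc hz hzz'⟩
    have hu' : ∃ L f, IsWalkThrough E B a u L f := by
      refine ⟨1, fun t => if t = 0 then a else u, by simp, by simp, fun i h h' => by omega, ?_⟩
      intro i hi
      obtain rfl : i = 0 := by omega
      simpa using hE _ _ hua
    have hback : ∀ z ∈ B, (∃ L f, IsWalkThrough E B a z L f) →
        ∃ L f, IsWalkThrough E B a y L f := by
      intro z hz
      induction hz with
      | refl => exact id
      | tail hz hr ihz => exact fun h => ihz (hstep _ (hz.tail hr) _ (hE _ _ hr.2) h)
    have hforth : ∀ z ∈ B, ∃ L f, IsWalkThrough E B a z L f := by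
      intro z hz
      induction hz with
      | refl => exact hback u hu hu'
      | tail hz hr ihz => exact hstep _ hz _ hr.2 ihz
    exact hforth w hw
  have hN : ∀ a c, a ≠ x → c ≠ x → (x, a) ∈ E → (x, c) ∈ E → (∃ u ∈ B, (u, a) ∈ E) →
      (∃ u ∈ B, (u, c) ∈ E) → a ≠ c → (a, c) ∈ E := by
    intro a c hax hcx hxa hxc ⟨u, hu, hua⟩ ⟨w, hw, hwc⟩ hac
    refine hch.adj_of_isWalkThrough hE (fun h => (hBT x h).2.1 rfl) (fun z hz => (hBT z hz).2.2)
      hax hcx hxa hxc hac ?_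
    obtain ⟨L, f, hf⟩ := hBconn a u hu hua w hw
    exact ⟨L + 1, _, hf.snoc hw hwc⟩
  by_cases hA : ∃ a ∈ S', a ∉ B ∧ ∃ z ∈ S', z ≠ a ∧ (a, z) ∉ E
  · obtain ⟨a, ha, haB, z, hz, hza, haz⟩ := hA
    obtain ⟨w, hw, hwa, haw, hs⟩ := ih S' hS'S a ha z hz hza haz
    refine hlift w ?_ hs
    rcases (Finset.mem_filter.1 hw).2 with h | h
    · exact h
    · rcases (Finset.mem_filter.1 ha).2 with h' | h'
      · exact absurd h' haB
      · exact absurd (hN a w h'.1 h.1 h'.2.1 h.2.1 h'.2.2 h.2.2 hwa.symm) haw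
  · by_cases hC : ∃ z ∈ S', ∃ w ∈ S', w ≠ z ∧ (z, w) ∉ E
    · obtain ⟨z, hz, w₀, hw₀, hne, hzw₀⟩ := hC
      obtain ⟨w, hw, hwz, hzw, hs⟩ := ih S' hS'S z hz w₀ hw₀ hne hzw₀
      refine hlift w ?_ hs
      by_contra hwB
      exact hA ⟨w, hw, hwB, z, hz, hwz.symm, fun h => hzw (hE _ _ h)⟩
    · refine hlift y hyB fun a ha c hc _ _ hac => ?_
      by_contra h
      exact hC ⟨a, ha, c, hc, hac.symm, h⟩

theorem IsChordal.exists_isSimplicialIn {n : ℕ} {E : Set (Fin n × Fin n)} (hE : SymmEdges E)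
    (hch : IsChordal E) {S : Finset (Fin n)} (hS : S.Nonempty) :
    ∃ v ∈ S, IsSimplicialIn E S v := by
  by_cases h : ∃ x ∈ S, ∃ y ∈ S, y ≠ x ∧ (x, y) ∉ E
  · obtain ⟨x, hx, y, hy, hyx, hxy⟩ := h
    obtain ⟨w, hw, -, -, hs⟩ := hch.exists_isSimplicialIn_not_adj hE S x hx y hy hyx hxy
    exact ⟨w, hw, hs⟩
  · obtain ⟨v, hv⟩ := hS
    refine ⟨v, hv, fun a ha c hc _ _ hac => ?_⟩
    by_contra hn
    exact h ⟨a, ha, c, hc, hac.symm, hn⟩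

theorem selector_transpose_mul_selector {n : ℕ} (D : Finset (Fin n)) :
    (selector D)ᵀ * selector D = diagonal fun i => if i ∈ D then 1 else 0 := by
  ext i j
  simp only [mul_apply, transpose_apply, selector, of_apply, diagonal_apply]
  refine (Equiv.sum_comp (D.orderIsoOfFin rfl).toEquiv
    (fun x : D => (if x.1 = i then (1 : ℝ) else 0) * if x.1 = j then 1 else 0)).trans ?_
  rw [Finset.sum_coe_sort D (fun x => (if x = i then (1 : ℝ) else 0) * if x = j then 1 else 0)]
  by_cases hij : i = j
  · subst hij
    simp
  · simp [hij, Ne.symm hij]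

theorem Matrix.PosSemidef.selector_congr {n : ℕ} {D : Finset (Fin n)}
    {Z : Matrix (Fin D.card) (Fin D.card) ℝ} (hZ : Z.PosSemidef) :
    ((selector D)ᵀ * Z * selector D).PosSemidef := by
  simpa [conjTranspose_eq_transpose_of_trivial] using hZ.conjTranspose_mul_mul_same (selector D)

/-- `X` is a sum of positive semidefinite matrices, each supported on one of the sets `C k`. -/
def IsCliqueSum {n p : ℕ} (C : Fin p → Finset (Fin n)) (X : Matrix (Fin n) (Fin n) ℝ) : Prop :=
  ∃ Z : (k : Fin p) → Matrix (Fin (C k).card) (Fin (C k).card) ℝ,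
    (∀ k, (Z k).PosSemidef) ∧ ∑ k, (selector (C k))ᵀ * Z k * selector (C k) = X

theorem IsCliqueSum.zero {n p : ℕ} (C : Fin p → Finset (Fin n)) : IsCliqueSum C 0 :=
  ⟨fun _ => 0, fun _ => PosSemidef.zero, by simp⟩

theorem IsCliqueSum.add {n p : ℕ} {C : Fin p → Finset (Fin n)} {X Y : Matrix (Fin n) (Fin n) ℝ}
    (hX : IsCliqueSum C X) (hY : IsCliqueSum C Y) : IsCliqueSum C (X + Y) := by
  obtain ⟨Z, hZ, rfl⟩ := hX
  obtain ⟨W, hW, rfl⟩ := hY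
  exact ⟨fun k => Z k + W k, fun k => (hZ k).add (hW k), by
    simp only [Matrix.mul_add, Matrix.add_mul, Finset.sum_add_distrib]⟩

theorem IsCliqueSum.of_support {n p : ℕ} {C : Fin p → Finset (Fin n)}
    {X : Matrix (Fin n) (Fin n) ℝ} (hX : X.PosSemidef) (k : Fin p)
    (hsupp : ∀ i j, X i j ≠ 0 → i ∈ C k ∧ j ∈ C k) : IsCliqueSum C X := by
  refine ⟨Pi.single k (selector (C k) * X * (selector (C k))ᵀ), ?_, ?_⟩
  · intro l
    rcases eq_or_ne l k with rfl | hl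
    · rw [Pi.single_eq_same]
      simpa [conjTranspose_eq_transpose_of_trivial] using
        hX.mul_mul_conjTranspose_same (selector (C l))
    · rw [Pi.single_eq_of_ne hl]
      exact PosSemidef.zero
  · rw [Finset.sum_eq_single k (fun l _ hl => by simp [Pi.single_eq_of_ne hl]) (by simp),
      Pi.single_eq_same,
      show (selector (C k))ᵀ * (selector (C k) * X * (selector (C k))ᵀ) * selector (C k) =
        ((selector (C k))ᵀ * selector (C k)) * X * ((selector (C k))ᵀ * selector (C k)) by
        simp only [Matrix.mul_assoc], selector_transpose_mul_selector]
    ext i j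
    rw [mul_diagonal, diagonal_mul]
    by_cases h : X i j = 0
    · simp [h]
    · simp [(hsupp i j h).1, (hsupp i j h).2]

theorem Matrix.PosSemidef.apply_eq_zero_of_diag_eq_zero {ι : Type*} [Finite ι] {X : Matrix ι ι ℝ}
    (hX : X.PosSemidef) {v : ι} (hv : X v v = 0) (j : ι) : X v j = 0 := by
  have h := (hX.submatrix ![v, j]).det_nonneg
  have hs : X j v = X v j := by simpa using hX.isHermitian.apply v j
  rw [det_fin_two] at h
  simp [hv, hs] at h
  nlinarith

/-- Subtracting the rank one matrix that clears row and column `v` preserves positive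
semidefiniteness. -/
theorem Matrix.PosSemidef.sub_smul_vecMulVec {ι : Type*} [Fintype ι] {X : Matrix ι ι ℝ}
    (hX : X.PosSemidef) {v : ι} (hv : X v v ≠ 0) :
    (X - (X v v)⁻¹ • vecMulVec (X v) (X v)).PosSemidef := by
  classical
  have hs : Xᵀ = X := by simpa [conjTranspose_eq_transpose_of_trivial] using hX.isHermitian.eq
  have hrow : Pi.single v 1 ᵥ* X = X v := by
    ext i
    simp
  have h := hX.conjTranspose_mul_mul_same (1 - (X v v)⁻¹ • vecMulVec (Pi.single v 1) (X v))
  convert h using 1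
  rw [conjTranspose_eq_transpose_of_trivial]
  simp only [transpose_sub, transpose_one, transpose_smul, transpose_vecMulVec, Matrix.sub_mul,
    Matrix.mul_sub, Matrix.one_mul, Matrix.mul_one, Matrix.smul_mul, Matrix.mul_smul,
    mul_vecMulVec, vecMulVec_mul, hrow]
  ext i j
  have hvi : X i v = X v i := congrFun (congrFun hs v) i
  simp [vecMulVec_apply, hvi]
  field_simp
  ring

theorem IsClique.exists_subset_isMaximalClique {n : ℕ} {E : Set (Fin n × Fin n)}
    {D : Finset (Fin n)} (hD : IsClique E D) : ∃ M, D ⊆ M ∧ IsMaximalClique E M := by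
  obtain ⟨M, hDM, hM⟩ := (Set.toFinite {M | IsClique E M}).exists_le_maximal hD
  exact ⟨M, hDM, hM.prop, fun F hF hMF => (hM.le_of_ge hF hMF).antisymm hMF⟩

/-- A positive semidefinite matrix with chordal sparsity pattern is a sum of positive semidefinite
matrices supported on maximal cliques. -/
theorem SparsePSD.isCliqueSum {n p : ℕ} {E : Set (Fin n × Fin n)} (hE : SymmEdges E)
    (hch : IsChordal E) {C : Fin p → Finset (Fin n)}
    (hall : ∀ D : Finset (Fin n), IsMaximalClique E D → ∃ k : Fin p, C k = D)
    {X : Matrix (Fin n) (Fin n) ℝ} (hX : SparsePSD E X) : IsCliqueSum C X := by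
  classical
  suffices h : ∀ (S : Finset (Fin n)) (X : Matrix (Fin n) (Fin n) ℝ), SparsePSD E X →
      (∀ i j, i ∉ S → X i j = 0) → IsCliqueSum C X from h Finset.univ X hX (by simp)
  intro S
  induction S using Finset.strongInduction with
  | H S ih =>
  intro X hX hsupp
  rcases S.eq_empty_or_nonempty with rfl | hS
  · obtain rfl : X = 0 := by
      ext i j
      exact hsupp i j (Finset.notMem_empty i)
    exact IsCliqueSum.zero C
  obtain ⟨v, hvS, hv⟩ := hch.exists_isSimplicialIn hE hS
  obtain ⟨⟨hsymm, hsparse⟩, hpsd⟩ := hX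
  by_cases hvv : X v v = 0
  · refine ih _ (Finset.erase_ssubset hvS) X ⟨⟨hsymm, hsparse⟩, hpsd⟩ fun i j hi => ?_
    rcases eq_or_ne i v with rfl | hiv
    · exact hpsd.apply_eq_zero_of_diag_eq_zero hvv j
    · exact hsupp i j fun h => hi (Finset.mem_erase.2 ⟨hiv, h⟩)
  · let D : Finset (Fin n) := Finset.univ.filter fun i => X v i ≠ 0
    have hmem : ∀ i ∈ D, i ∈ S ∧ (i ≠ v → (v, i) ∈ E) := by
      intro i hi
      have hi' : X v i ≠ 0 := (Finset.mem_filter.1 hi).2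
      refine ⟨?_, fun hne => ?_⟩
      · by_contra h
        exact hi' ((hsymm.apply i v).trans (hsupp i v h))
      · by_contra h
        refine hi' (hsparse v i ?_)
        rintro (h' | h')
        · exact h h'
        · exact hne h'.symm
    have hD : IsClique E D := by
      intro i hi j hj hij
      rcases eq_or_ne i v with rfl | hiv
      · exact (hmem j hj).2 hij.symm
      · rcases eq_or_ne j v with rfl | hjv
        · exact hE _ _ ((hmem i hi).2 hiv)
        · exact hv i (hmem i hi).1 j (hmem j hj).1 ((hmem i hi).2 hiv) ((hmem j hj).2 hjv) hij
    set R := (X v v)⁻¹ • vecMulVec (X v) (X v) with hR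
    have hRD : ∀ i j, R i j ≠ 0 → i ∈ D ∧ j ∈ D := by
      intro i j h
      simp only [hR, Matrix.smul_apply, vecMulVec_apply, smul_eq_mul, mul_ne_zero_iff] at h
      simpa [D] using h.2
    have hRpsd : R.PosSemidef := by
      have h := posSemidef_vecMulVec_self_star (X v)
      rw [star_trivial] at h
      exact h.smul (inv_nonneg.2 hpsd.diag_nonneg)
    obtain ⟨M, hDM, hM⟩ := hD.exists_subset_isMaximalClique
    obtain ⟨k, rfl⟩ := hall M hM
    have hsub : (X - R).PosSemidef := hpsd.sub_smul_vecMulVec hvv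
    rw [← sub_add_cancel X R]
    refine IsCliqueSum.add (ih _ (Finset.erase_ssubset hvS) _ ⟨⟨?_, ?_⟩, hsub⟩ ?_)
      (IsCliqueSum.of_support hRpsd k fun i j h => ⟨hDM (hRD i j h).1, hDM (hRD i j h).2⟩)
    · simpa [IsSymm, IsHermitian, conjTranspose_eq_transpose_of_trivial] using hsub.isHermitian
    · intro i j hij
      rw [Matrix.sub_apply, hsparse i j hij, zero_sub, neg_eq_zero]
      by_contra h
      obtain ⟨hi, hj⟩ := hRD i j h
      exact hij (or_iff_not_imp_right.2 fun hne => hD i hi j hj hne)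
    · intro i j hi
      rcases eq_or_ne i v with rfl | hiv
      · simp [hR, vecMulVec_apply, hvv]
      · have hiS : i ∉ S := fun h => hi (Finset.mem_erase.2 ⟨hiv, h⟩)
        have hvi : X v i = 0 := (hsymm.apply i v).trans (hsupp i v hiS)
        simp [hR, vecMulVec_apply, hsupp i j hiS, hvi]

/-- **Range-space decomposition.** Let `G(V,E)` be a chordal graph with maximal cliques
`C_1, …, C_p`, and suppose `C ∈ S^n(E,0)` and `A_i ∈ S^n(E,0)`.  Then the optimal value of
the standard dual SDP `sup {bᵀy : C − Σ_i A_i y_i ⪰ 0}` equals the optimal value of the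
range-space decomposed SDP `sup {bᵀy : Σ_i A_i y_i + Σ_k E_{C_k}ᵀ Z_k E_{C_k} = C, Z_k ⪰ 0}`. -/
theorem range_space_decomposition {n m p : ℕ} (E : Set (Fin n × Fin n)) (hE : SymmEdges E)
    (hchordal : IsChordal E) (C : Fin p → Finset (Fin n))
    (hmax : ∀ k : Fin p, IsMaximalClique E (C k))
    (hall : ∀ D : Finset (Fin n), IsMaximalClique E D → ∃ k : Fin p, C k = D)
    (b : Fin m → ℝ) (Cmat : Matrix (Fin n) (Fin n) ℝ) (A : Fin m → Matrix (Fin n) (Fin n) ℝ)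
    (hCmat : SparseSym E Cmat) (hA : ∀ i : Fin m, SparseSym E (A i)) :
    sSup {v : EReal | ∃ y : Fin m → ℝ,
        (Cmat - ∑ i : Fin m, y i • A i).PosSemidef ∧
        v = ((∑ i : Fin m, b i * y i : ℝ) : EReal)} =
    sSup {v : EReal | ∃ (y : Fin m → ℝ)
        (Zk : (k : Fin p) → Matrix (Fin (C k).card) (Fin (C k).card) ℝ),
        (∀ k : Fin p, (Zk k).PosSemidef) ∧
        (∑ i : Fin m, y i • A i) +
          (∑ k : Fin p, (selector (C k))ᵀ * Zk k * selector (C k)) = Cmat ∧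
        v = ((∑ i : Fin m, b i * y i : ℝ) : EReal)} := by
  congr 1
  ext t
  constructor
  · rintro ⟨y, hy, rfl⟩
    have hsparse : SparseSym E (Cmat - ∑ i, y i • A i) := by
      refine ⟨?_, fun i j hij => ?_⟩
      · simpa [IsSymm, IsHermitian, conjTranspose_eq_transpose_of_trivial] using hy.isHermitian
      · simp [Matrix.sub_apply, Matrix.sum_apply, hCmat.2 i j hij, fun l => (hA l).2 i j hij]
    obtain ⟨Z, hZ, hsum⟩ := SparsePSD.isCliqueSum hE hchordal hall ⟨hsparse, hy⟩
    exact ⟨y, Z, hZ, by rw [hsum, add_sub_cancel], rfl⟩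
  · rintro ⟨y, Z, hZ, hsum, rfl⟩
    refine ⟨y, ?_, rfl⟩
    rw [← hsum, add_sub_cancel_left]
    exact posSemidef_sum _ fun k _ => (hZ k).selector_congr
end
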